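/- arXiv:1712.02271 — 2 statements merged into one kernel-verified Lean document; each statement's English description precedes it below -/
import Mathlib

section
/- The total number of simple walks of length n in the quarter plane ℤ₊² starting at the origin (arbitrary endpoint) satisfies Σ_{i,j≥0} f(i,j,n) ~ (4/π)·4ⁿ/n as n → ∞. -/
open Filter

/-- A sequence of steps is a simple quarter-plane walk if every step is one of
E, W, N, S and every partial sum stays in `ℤ₊²`. -/
def IsQWalk (l : List (ℤ × ℤ)) : Prop :=
  (∀ s ∈ l, s ∈ ({(1, 0), (-1, 0), (0, 1), (0, -1)} : Set (ℤ × ℤ))) ∧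
  ∀ k ≤ l.length, 0 ≤ ((l.take k).sum).1 ∧ 0 ≤ ((l.take k).sum).2

/-- `qwalkTotal n` = number of simple quarter-plane walks of length `n`
starting at the origin, with arbitrary endpoint. -/
noncomputable def qwalkTotal (n : ℕ) : ℕ :=
  Nat.card {l : List (ℤ × ℤ) // l.length = n ∧ IsQWalk l}

namespace QW

/-- Number of one-dimensional walks of length `n` from `0` to `z`. -/
def B : ℕ → ℤ → ℤ
  | 0, z => if z = 0 then 1 else 0
  | n + 1, z => B n (z - 1) + B n (z + 1)

/-- Antisymmetric solution of the unrestricted recurrence. -/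
def H : ℕ → ℤ → ℤ → ℤ
  | 0, x, y => x.sign * y.sign
  | n + 1, x, y => H n (x + 1) y + H n (x - 1) y + H n x (y + 1) + H n x (y - 1)

/-- Number of unrestricted two-dimensional walks. -/
def g (n : ℕ) (x y : ℤ) : ℤ := B n (x + y) * B n (x - y)

lemma B_succ (n : ℕ) (z : ℤ) : B (n + 1) z = B n (z - 1) + B n (z + 1) := rfl

lemma H_succ (n : ℕ) (x y : ℤ) :
    H (n + 1) x y = H n (x + 1) y + H n (x - 1) y + H n x (y + 1) + H n x (y - 1) := rfl

lemma g_zero (x y : ℤ) : g 0 x y = if x = 0 ∧ y = 0 then 1 else 0 := by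
  simp only [g, B]
  split_ifs <;> first | rfl | omega

lemma g_succ (n : ℕ) (x y : ℤ) :
    g (n + 1) x y = g n (x + 1) y + g n (x - 1) y + g n x (y + 1) + g n x (y - 1) := by
  simp only [g, B_succ]
  rw [show x + 1 + y = x + y + 1 by ring, show x + 1 - y = x - y + 1 by ring,
    show x - 1 + y = x + y - 1 by ring, show x - 1 - y = x - y - 1 by ring,
    show x + (y + 1) = x + y + 1 by ring, show x - (y + 1) = x - y - 1 by ring,
    show x + (y - 1) = x + y - 1 by ring, show x - (y - 1) = x - y + 1 by ring]
  ring

lemma H_neg_left (n : ℕ) : ∀ x y : ℤ, H n (-x) y = - H n x y := by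
  induction n with
  | zero => intro x y; simp [H]
  | succ n ih =>
    intro x y
    simp only [H_succ]
    rw [show -x + 1 = -(x - 1) by ring, show -x - 1 = -(x + 1) by ring]
    simp only [ih]
    ring

lemma H_neg_right (n : ℕ) : ∀ x y : ℤ, H n x (-y) = - H n x y := by
  induction n with
  | zero => intro x y; simp [H]
  | succ n ih =>
    intro x y
    simp only [H_succ]
    rw [show -y + 1 = -(y - 1) by ring, show -y - 1 = -(y + 1) by ring]
    simp only [ih]
    ring

lemma H_zero_left (n : ℕ) (y : ℤ) : H n 0 y = 0 := by
  have := H_neg_left n 0 y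
  simp only [neg_zero] at this
  omega

lemma H_zero_right (n : ℕ) (x : ℤ) : H n x 0 = 0 := by
  have := H_neg_right n x 0
  simp only [neg_zero] at this
  omega

lemma sign_diff (x : ℤ) : (x + 1).sign - (x - 1).sign =
    2 * (if x = 0 then 1 else 0) + (if x = 1 then 1 else 0) + (if x = -1 then 1 else 0) := by
  rcases lt_trichotomy x 0 with h | h | h
  · rw [Int.sign_eq_neg_one_of_neg (show x - 1 < 0 by omega)]
    by_cases h1 : x = -1
    · subst h1; simp
    · rw [Int.sign_eq_neg_one_of_neg (show x + 1 < 0 by omega)]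
      simp [h1, h.ne, show x ≠ 1 by omega]
  · subst h; simp
  · rw [Int.sign_eq_one_of_pos (show 0 < x + 1 by omega)]
    by_cases h1 : x = 1
    · subst h1; simp
    · rw [Int.sign_eq_one_of_pos (show 0 < x - 1 by omega)]
      simp [h1, h.ne', show x ≠ -1 by omega]

lemma D_eq (n : ℕ) : ∀ x y : ℤ,
    H n (x + 1) (y + 1) - H n (x - 1) (y + 1) - H n (x + 1) (y - 1) + H n (x - 1) (y - 1) =
    4 * g n x y + 2 * g n (x - 1) y + 2 * g n (x + 1) y + 2 * g n x (y - 1) + 2 * g n x (y + 1)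
    + g n (x - 1) (y - 1) + g n (x - 1) (y + 1) + g n (x + 1) (y - 1) + g n (x + 1) (y + 1) := by
  induction n with
  | zero =>
    intro x y
    have h : H 0 (x + 1) (y + 1) - H 0 (x - 1) (y + 1) - H 0 (x + 1) (y - 1)
        + H 0 (x - 1) (y - 1)
        = ((x + 1).sign - (x - 1).sign) * ((y + 1).sign - (y - 1).sign) := by
      simp only [H]; ring
    have e : ∀ a b : ℤ, g 0 a b = (if a = 0 then 1 else 0) * (if b = 0 then 1 else 0) := by
      intro a b; rw [g_zero]; split_ifs <;> simp_all
    rw [h, sign_diff, sign_diff]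
    simp only [e, sub_eq_zero, add_eq_zero_iff_eq_neg]
    ring
  | succ n ih =>
    intro x y
    have h1 := ih (x + 1) y
    have h2 := ih (x - 1) y
    have h3 := ih x (y + 1)
    have h4 := ih x (y - 1)
    simp only [H_succ, g_succ]
    simp only [add_sub_cancel_right, sub_add_cancel] at *
    linarith

lemma B_neg (n : ℕ) : ∀ z : ℤ, B n (-z) = B n z := by
  induction n with
  | zero => intro z; simp [B]
  | succ n ih =>
    intro z
    simp only [B_succ]
    rw [show -z + 1 = -(z - 1) by ring, show -z - 1 = -(z + 1) by ring]
    simp only [ih]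
    ring

lemma H_one (n : ℕ) : H n 1 1 = B n 0 ^ 2 + 2 * B n 1 ^ 2 + B n 0 * B n 2 := by
  have h := D_eq n 0 0
  have a := H_neg_left n 1 1
  have b := H_neg_right n 1 1
  have c := H_neg_right n (-1) 1
  have d1 := B_neg n 1
  have d2 := B_neg n 2
  simp only [g] at h
  norm_num at h
  rw [d1, d2] at h
  linarith

lemma B_odd (n : ℕ) : ∀ z : ℤ, (n + z) % 2 = 1 → B n z = 0 := by
  induction n with
  | zero => intro z hz; simp only [B]; rw [if_neg]; rintro rfl; simp at hz
  | succ n ih =>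
    intro z hz
    push_cast at hz
    rw [B_succ, ih _ (by omega), ih _ (by omega), add_zero]

lemma B_large (n : ℕ) : ∀ z : ℤ, (n : ℤ) < z → B n z = 0 := by
  induction n with
  | zero => intro z hz; simp only [B]; rw [if_neg]; rintro rfl; simp at hz
  | succ n ih =>
    intro z hz
    push_cast at hz
    rw [B_succ, ih _ (by omega), ih _ (by omega), add_zero]

lemma B_choose (n : ℕ) : ∀ k : ℕ, B n (2 * k - n) = n.choose k := by
  induction n with
  | zero =>
    intro k
    cases k with
    | zero => simp [B]
    | succ k => simp only [B]; rw [if_neg (by push_cast; omega)]; simp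
  | succ n ih =>
    intro k
    cases k with
    | zero =>
      rw [B_succ, ← B_neg n (_ - 1), B_large n _ (by push_cast; omega)]
      have := ih 0
      simp only [Nat.choose_zero_right] at *
      rw [← this, zero_add]
      congr 1; push_cast; ring
    | succ k =>
      rw [B_succ, Nat.choose_succ_succ, Nat.cast_add (n.choose k), ← ih, ← ih]
      congr 2 <;> (push_cast; ring)

lemma B_central (m : ℕ) : B (2 * m) 0 = m.centralBinom := by
  have := B_choose (2 * m) m
  rw [Nat.centralBinom, ← this]
  congr 1; push_cast; ring

lemma B_step (m : ℕ) : ((m + 1).centralBinom : ℤ) = 2 * B (2 * m + 1) 1 := by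
  rw [← B_central, show 2 * (m + 1) = (2 * m + 1) + 1 by ring, B_succ]
  have := B_neg (2 * m + 1) 1
  simp only [zero_sub, zero_add]
  rw [this]; ring

lemma H_even (m : ℕ) : 2 * H (2 * m) 1 1 = m.centralBinom * (m + 1).centralBinom := by
  rw [H_one, B_step, B_odd (2 * m) 1 (by push_cast; omega), B_succ, ← B_central]
  norm_num
  ring

lemma H_odd (m : ℕ) : 2 * H (2 * m + 1) 1 1 = (m + 1).centralBinom ^ 2 := by
  rw [H_one, B_step, B_odd (2 * m + 1) 0 (by push_cast; omega)]
  ring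

/-- The finite set of steps. -/
def steps : Finset (ℤ × ℤ) := {(1, 0), (-1, 0), (0, 1), (0, -1)}

/-- Walks of length `n` from `p` staying in the quadrant. -/
def F : ℕ → ℤ × ℤ → Finset (List (ℤ × ℤ))
  | 0, p => if 0 ≤ p.1 ∧ 0 ≤ p.2 then {[]} else ∅
  | n + 1, p => if 0 ≤ p.1 ∧ 0 ≤ p.2 then
      steps.biUnion (fun s => (F n (p + s)).image (List.cons s)) else ∅

lemma mem_F (n : ℕ) : ∀ (p : ℤ × ℤ) (l : List (ℤ × ℤ)), l ∈ F n p ↔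
    l.length = n ∧ (∀ s ∈ l, s ∈ steps) ∧
    ∀ k ≤ l.length, 0 ≤ (p + (l.take k).sum).1 ∧ 0 ≤ (p + (l.take k).sum).2 := by
  induction n with
  | zero =>
    intro p l
    rw [F]
    constructor
    · split_ifs with h
      · intro hl
        rw [Finset.mem_singleton] at hl
        subst hl
        simpa using h
      · simp
    · rintro ⟨h1, -, h3⟩
      rw [List.length_eq_zero_iff] at h1
      subst h1
      have := h3 0 le_rfl
      simp at this
      simp [this]
  | succ n ih =>
    intro p l
    rw [F]
    constructor
    · split_ifs with h
      · intro hl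
        simp only [Finset.mem_biUnion, Finset.mem_image] at hl
        obtain ⟨s, hs, t, ht, rfl⟩ := hl
        obtain ⟨a, b, c⟩ := (ih _ _).1 ht
        refine ⟨by simp [a], ?_, ?_⟩
        · intro u hu
          rcases List.mem_cons.1 hu with rfl | hu
          · exact hs
          · exact b u hu
        · intro k hk
          cases k with
          | zero => simpa using h
          | succ k =>
            have := c k (by simpa using hk)
            rwa [List.take_succ_cons, List.sum_cons, ← add_assoc]
      · simp
    · rintro ⟨h1, h2, h3⟩
      have h0 := h3 0 (Nat.zero_le _)
      simp only [List.take_zero, List.sum_nil, add_zero] at h0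
      rw [if_pos h0]
      cases l with
      | nil => simp at h1
      | cons s t =>
        simp only [Finset.mem_biUnion, Finset.mem_image]
        refine ⟨s, h2 s (by simp), t, (ih _ _).2 ⟨by simpa using h1, ?_, ?_⟩, rfl⟩
        · intro u hu; exact h2 u (by simp [hu])
        · intro k hk
          have := h3 (k + 1) (by simpa using hk)
          rwa [List.take_succ_cons, List.sum_cons, ← add_assoc] at this

lemma card_F_succ (n : ℕ) (x y : ℤ) (hx : 0 ≤ x) (hy : 0 ≤ y) :
    (F (n + 1) (x, y)).card = (F n (x + 1, y)).card + (F n (x - 1, y)).card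
      + (F n (x, y + 1)).card + (F n (x, y - 1)).card := by
  rw [F, if_pos ⟨hx, hy⟩, Finset.card_biUnion]
  · simp only [Finset.card_image_of_injective _ (List.cons_injective)]
    simp [steps, sub_eq_add_neg, add_assoc]
  · intro s _ t _ hst
    rw [Function.onFun, Finset.disjoint_left]
    intro l hl hl'
    simp only [Finset.mem_image] at hl hl'
    obtain ⟨a, _, rfl⟩ := hl
    obtain ⟨b, _, h⟩ := hl'
    simp only [List.cons.injEq] at h
    exact hst h.1.symm

lemma card_F_out (n : ℕ) (x y : ℤ) (h : ¬ (0 ≤ x ∧ 0 ≤ y)) : (F n (x, y)).card = 0 := by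
  cases n <;> simp [F, h]

lemma card_F (n : ℕ) : ∀ x y : ℤ, -1 ≤ x → -1 ≤ y →
    ((F n (x, y)).card : ℤ) = H n (x + 1) (y + 1) := by
  induction n with
  | zero =>
    intro x y hx hy
    by_cases h : 0 ≤ x ∧ 0 ≤ y
    · simp only [F, H]
      rw [if_pos h, Int.sign_eq_one_of_pos (by omega), Int.sign_eq_one_of_pos (by omega)]
      simp
    · rw [card_F_out _ _ _ h]
      rcases (show x = -1 ∨ y = -1 by omega) with rfl | rfl <;> simp [H]
  | succ n ih =>
    intro x y hx hy
    by_cases h : 0 ≤ x ∧ 0 ≤ y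
    · rw [card_F_succ _ _ _ h.1 h.2, H_succ]
      push_cast
      rw [ih _ _ (by omega) (by omega), ih _ _ (by omega) (by omega),
        ih _ _ (by omega) (by omega), ih _ _ (by omega) (by omega)]
      simp only [add_sub_cancel_right, sub_add_cancel]
    · rw [card_F_out _ _ _ h]
      rcases (show x = -1 ∨ y = -1 by omega) with rfl | rfl
      · simp [H_zero_left]
      · simp [H_zero_right]

lemma total_eq (n : ℕ) : (qwalkTotal n : ℤ) = H n 1 1 := by
  have h := card_F n 0 0 (by norm_num) (by norm_num)
  rw [zero_add] at h
  rw [← h, qwalkTotal]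
  congr 1
  rw [← Nat.card_eq_finsetCard]
  apply Nat.card_congr
  apply Equiv.subtypeEquivRight
  intro l
  rw [mem_F]
  have e : ((0, 0) : ℤ × ℤ) = 0 := rfl
  simp only [IsQWalk, steps, e, zero_add]
  simp

open Real in
lemma r_tendsto : Tendsto (fun m : ℕ => (m.centralBinom : ℝ) ^ 2 * (2 * m + 1) / 16 ^ m)
    atTop (nhds (2 / π)) := by
  have h := (Real.Wallis.tendsto_W_nhds_pi_div_two).inv₀ (by positivity)
  rw [inv_div] at h
  refine h.congr fun m => ?_
  rw [Real.Wallis.W_eq_factorial_ratio]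
  have hc : (m.centralBinom : ℝ) = (2 * m).factorial / (m.factorial : ℝ) ^ 2 := by
    have := Nat.choose_mul_factorial_mul_factorial (show m ≤ 2 * m by omega)
    rw [show 2 * m - m = m by omega] at this
    rw [Nat.centralBinom, ← this]
    have : (m.factorial : ℝ) ≠ 0 := by positivity
    push_cast
    field_simp
  rw [hc, show (16 : ℝ) ^ m = 2 ^ (4 * m) by rw [pow_mul]; norm_num]
  have : (m.factorial : ℝ) ≠ 0 := by positivity
  have : ((2 * m).factorial : ℝ) ≠ 0 := by positivity
  field_simp

lemma frac_tendsto (a b c d : ℝ) (hc : c ≠ 0) :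
    Tendsto (fun m : ℕ => (a * m + b) / (c * m + d)) atTop (nhds (a / c)) := by
  have h1 : Tendsto (fun m : ℕ => (a + b / (m : ℝ)) / (c + d / (m : ℝ))) atTop
      (nhds ((a + 0) / (c + 0))) :=
    (tendsto_const_nhds.add (tendsto_const_div_atTop_nhds_zero_nat b)).div
      (tendsto_const_nhds.add (tendsto_const_div_atTop_nhds_zero_nat d)) (by simpa)
  rw [add_zero, add_zero] at h1
  refine h1.congr' ?_
  filter_upwards [eventually_gt_atTop 0] with m hm
  have : (m : ℝ) ≠ 0 := by positivity
  rw [← mul_div_mul_right _ _ this]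
  congr 1 <;> field_simp

open Real in
lemma even_tendsto : Tendsto (fun m : ℕ => (qwalkTotal (2 * m) : ℝ) /
    (4 / π * 4 ^ (2 * m) / ((2 * m : ℕ) : ℝ))) atTop (nhds 1) := by
  have h := (r_tendsto.mul (frac_tendsto 1 0 1 1 one_ne_zero)).const_mul (π / 2)
  rw [show π / 2 * (2 / π * (1 / 1)) = 1 by field_simp] at h
  refine h.congr' ?_
  filter_upwards [eventually_gt_atTop 0] with m hm
  have h1 : 2 * (qwalkTotal (2 * m) : ℝ) = m.centralBinom * (m + 1).centralBinom := by
    have := H_even m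
    rw [← total_eq] at this
    exact_mod_cast this
  have h2 : ((m : ℝ) + 1) * (m + 1).centralBinom = 2 * (2 * m + 1) * m.centralBinom := by
    exact_mod_cast Nat.succ_mul_centralBinom_succ m
  have h3 : (qwalkTotal (2 * m) : ℝ) = (2 * m + 1) * (m.centralBinom : ℝ) ^ 2 / (m + 1) := by
    rw [eq_div_iff (by positivity)]
    linear_combination ((m : ℝ) + 1) / 2 * h1 + (m.centralBinom : ℝ) / 2 * h2
  have : (m : ℝ) ≠ 0 := by positivity
  rw [h3, pow_mul]
  push_cast
  norm_num
  field_simp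
  try ring

open Real in
lemma odd_tendsto : Tendsto (fun m : ℕ => (qwalkTotal (2 * m + 1) : ℝ) /
    (4 / π * 4 ^ (2 * m + 1) / ((2 * m + 1 : ℕ) : ℝ))) atTop (nhds 1) := by
  have h := ((r_tendsto.comp (tendsto_add_atTop_nat 1)).mul
    (frac_tendsto 2 1 2 3 two_ne_zero)).const_mul (π / 2)
  rw [show π / 2 * (2 / π * (2 / 2)) = 1 by field_simp] at h
  refine h.congr fun m => ?_
  have h1 : 2 * (qwalkTotal (2 * m + 1) : ℝ) = (m + 1).centralBinom ^ 2 := by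
    have := H_odd m
    rw [← total_eq] at this
    exact_mod_cast this
  have h3 : (qwalkTotal (2 * m + 1) : ℝ) = ((m + 1).centralBinom : ℝ) ^ 2 / 2 := by
    linarith
  rw [h3, pow_succ (4 : ℝ), pow_mul]
  simp only [Function.comp]
  rw [pow_succ (16 : ℝ)]
  push_cast
  rw [show (2 : ℝ) * (m + 1) + 1 = 2 * m + 3 by ring]
  norm_num
  field_simp
  try norm_num

end QW

theorem stmt_13 :
    Tendsto (fun n : ℕ => (qwalkTotal n : ℝ) / (4 / Real.pi * 4 ^ n / (n : ℝ)))
      atTop (nhds 1) := by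
  have he := QW.even_tendsto
  have ho := QW.odd_tendsto
  rw [Filter.tendsto_def] at *
  intro s hs
  have h1 := he s hs
  have h2 := ho s hs
  rw [mem_atTop_sets] at *
  obtain ⟨a, ha⟩ := h1
  obtain ⟨b, hb⟩ := h2
  refine ⟨2 * a + 2 * b + 1, fun n hn => ?_⟩
  rcases Nat.even_or_odd' n with ⟨k, rfl | rfl⟩
  · exact ha k (by omega)
  · exact hb k (by omega)
end

section
/- Define F(0,0,z) = (1/π) ∫_{-1}^{1} [(1 - 2uz - √((1-2uz)² - 4z²))/z²] · √(1-u²) du for 0 < z < 1/4. Then F(0,0,z) = Σ_{n≥0} Cₙ C_{n+1} z^{2n}, where Cₙ is the n-th Catalan number; i.e., this integral formula gives the generating function of quarter-plane simple-walk excursions. -/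
open Finset

lemma cat_rec (j : ℕ) : ((j:ℝ)+2) * catalan (j+1) = (4*j+2) * catalan j := by
  have h1 := succ_mul_catalan_eq_centralBinom j
  have h2 := succ_mul_catalan_eq_centralBinom (j+1)
  have h3 := Nat.succ_mul_centralBinom_succ j
  rw [← h1, ← h2] at h3
  have h4 : ((j:ℝ)+1) * (((j:ℝ)+1+1) * catalan (j+1)) = 2 * (2*j+1) * ((j+1) * catalan j) := by
    exact_mod_cast h3
  have : ((j:ℝ)+1) ≠ 0 := by positivity
  apply mul_left_cancel₀ this
  linarith

lemma cat_fact (j : ℕ) : (catalan j : ℝ) * (j.factorial * (j+1).factorial) = (2*j).factorial := by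
  induction j with
  | zero => simp
  | succ j ih =>
    have h := cat_rec j
    have e : 2*(j+1) = 2*j+1+1 := by ring
    rw [e, Nat.factorial_succ (2*j+1), Nat.factorial_succ (2*j), Nat.factorial_succ (j+1)]
    push_cast
    rw [← ih, Nat.factorial_succ j]
    push_cast
    have : (catalan (j+1) : ℝ) = (4*j+2) * catalan j / (j+2) := by
      rw [← h]; field_simp
    rw [this]
    field_simp
    ring

lemma cat_comb (n : ℕ) : ∑ p ∈ HasAntidiagonal.antidiagonal n, (catalan p.1 : ℝ) * catalan p.2 * ((2*n).choose (2*p.2)) = catalan n * catalan (n+1) := by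
  have hv := Nat.add_choose_eq (n+1) (n+1) n
  have key : ∀ p ∈ HasAntidiagonal.antidiagonal n, (catalan p.1 : ℝ) * catalan p.2 * ((2*n).choose (2*p.2)) =
      ((2*n).factorial / ((n+1).factorial)^2 : ℝ) * ((n+1).choose p.1 * (n+1).choose p.2 : ℕ) := by
    rintro ⟨k, j⟩ hp
    simp only [HasAntidiagonal.mem_antidiagonal] at hp
    subst hp
    have a1 : ((2*(k+j)).choose (2*j) : ℝ) = (2*(k+j)).factorial / ((2*j).factorial * (2*k).factorial) := by
      rw [Nat.cast_choose ℝ (by omega), show 2*(k+j) - 2*j = 2*k by omega]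
    have a2 : ((k+j+1).choose k : ℝ) = (k+j+1).factorial / (k.factorial * (j+1).factorial) := by
      rw [Nat.cast_choose ℝ (by omega), show k+j+1 - k = j+1 by omega]
    have a3 : ((k+j+1).choose j : ℝ) = (k+j+1).factorial / (j.factorial * (k+1).factorial) := by
      rw [Nat.cast_choose ℝ (by omega), show k+j+1 - j = k+1 by omega]
    push_cast
    simp only [a1, a2, a3, ← cat_fact k, ← cat_fact j]
    have p1 : (catalan k : ℝ) ≠ 0 := by
      intro h; have := cat_fact k; rw [h, zero_mul] at this; exact absurd this.symm (Nat.cast_ne_zero.2 (Nat.factorial_ne_zero _))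
    have p2 : (catalan j : ℝ) ≠ 0 := by
      intro h; have := cat_fact j; rw [h, zero_mul] at this; exact absurd this.symm (Nat.cast_ne_zero.2 (Nat.factorial_ne_zero _))
    field_simp
  rw [sum_congr rfl key, ← mul_sum, ← Nat.cast_sum, ← hv, show n+1+(n+1) = 2*(n+1) by ring,
    Nat.cast_choose ℝ (by omega), show 2*(n+1) - n = n+1+1 by omega, ← cat_fact n, ← cat_fact (n+1)]
  field_simp

lemma cat_sum_le (n : ℕ) : ∑ k ∈ range n, (catalan k : ℝ) * (1/4)^k = 2 - 2 * (n+1) * catalan n * (1/4)^n := by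
  induction n with
  | zero => simp
  | succ n ih =>
    rw [sum_range_succ, ih]
    have h := cat_rec n
    push_cast
    rw [pow_succ]
    linear_combination (1/2 * (1/4:ℝ)^n) * h

lemma cat_partial_le {x : ℝ} (h0 : 0 ≤ x) (h1 : x ≤ 1/4) (n : ℕ) :
    ∑ k ∈ range n, (catalan k : ℝ) * x^k ≤ 2 := by
  calc _ ≤ ∑ k ∈ range n, (catalan k : ℝ) * (1/4)^k := by gcongr
    _ ≤ 2 := by
      rw [cat_sum_le]
      have : 0 ≤ 2 * ((n:ℝ)+1) * catalan n * (1/4)^n := by positivity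
      linarith

lemma cat_summable {x : ℝ} (h0 : 0 ≤ x) (h1 : x ≤ 1/4) :
    Summable fun k : ℕ => (catalan k : ℝ) * x^k :=
  summable_of_sum_range_le (fun _ => by positivity) (cat_partial_le h0 h1)

lemma cat_tsum {x : ℝ} (h0 : 0 ≤ x) (h1 : x ≤ 1/4) :
    2 * x * ∑' k : ℕ, (catalan k : ℝ) * x^k = 1 - √(1 - 4*x) := by
  have hs := cat_summable h0 h1
  have hle := Real.tsum_le_of_sum_range_le (fun k => by positivity) (cat_partial_le h0 h1)
  have hsn : Summable fun k : ℕ => ‖(catalan k : ℝ) * x^k‖ := hs.norm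
  have hq := tsum_mul_tsum_eq_tsum_sum_antidiagonal_of_summable_norm hsn hsn
  have h2 := hs.tsum_eq_zero_add
  have e : ∀ n : ℕ, (catalan (n+1) : ℝ) * x^(n+1) =
      x * ∑ p ∈ HasAntidiagonal.antidiagonal n, ((catalan p.1 : ℝ) * x^p.1) * ((catalan p.2 : ℝ) * x^p.2) := by
    intro n
    rw [catalan_succ', Nat.cast_sum, sum_mul, mul_sum]
    refine sum_congr rfl fun p hp => ?_
    rw [← HasAntidiagonal.mem_antidiagonal.1 hp]
    push_cast
    ring
  simp_rw [e] at h2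
  rw [tsum_mul_left, ← hq] at h2
  set c := ∑' k : ℕ, (catalan k : ℝ) * x^k
  simp at h2
  have : √(1 - 4*x) = 1 - 2*x*c := by
    rw [show 1 - 4*x = (1-2*x*c)^2 by linear_combination (4*x) * h2]
    exact Real.sqrt_sq (by nlinarith)
  linarith

lemma mom_rec (m : ℕ) : ((m:ℝ)+4) * ∫ u in (-1:ℝ)..1, u^(m+2) * √(1-u^2) =
    (m+1) * ∫ u in (-1:ℝ)..1, u^m * √(1-u^2) := by
  have hd : ∀ u ∈ Set.Ioo (-1:ℝ) 1, HasDerivAt (fun u : ℝ => u^(m+1) * ((1-u^2) * √(1-u^2)))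
      ((m+1) * (u^m * √(1-u^2)) - (m+4) * (u^(m+2) * √(1-u^2))) u := by
    intro u hu
    have hp : 0 < 1 - u^2 := by nlinarith [hu.1, hu.2]
    have h1 : HasDerivAt (fun u : ℝ => 1 - u^2) (-(2*u)) u := by
      simpa using (hasDerivAt_pow 2 u).const_sub 1
    have h2 := h1.sqrt hp.ne'
    have h3 := (hasDerivAt_pow (m+1) u).mul (h1.mul h2)
    refine h3.congr_deriv ?_
    have hs : √(1-u^2) ≠ 0 := (Real.sqrt_pos.2 hp).ne'
    have hq : √(1-u^2)^2 = 1-u^2 := Real.sq_sqrt hp.le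
    simp only [Pi.mul_apply, Nat.add_sub_cancel]
    have e : (1 - u^2) * (-(2*u) / (2*√(1-u^2))) = - u * √(1-u^2) := by
      field_simp; rw [hq]
    rw [e]
    push_cast
    ring
  have hc : ∀ m : ℕ, IntervalIntegrable (fun u : ℝ => u^m * √(1-u^2)) MeasureTheory.volume (-1) 1 :=
    fun m => (by fun_prop : Continuous fun u : ℝ => u^m * √(1-u^2)).intervalIntegrable _ _
  have := intervalIntegral.integral_eq_sub_of_hasDerivAt_of_le (by norm_num) 
    (by fun_prop) hd (((hc m).const_mul _).sub ((hc (m+2)).const_mul _))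
  rw [intervalIntegral.integral_sub ((hc m).const_mul _) ((hc (m+2)).const_mul _),
    intervalIntegral.integral_const_mul, intervalIntegral.integral_const_mul] at this
  norm_num at this
  linarith

lemma mom_even (j : ℕ) : ∫ u in (-1:ℝ)..1, u^(2*j) * √(1-u^2) = Real.pi / 2 * (catalan j / 4^j) := by
  induction j with
  | zero => simp [integral_sqrt_one_sub_sq]
  | succ j ih =>
    have h := mom_rec (2*j)
    rw [ih] at h
    have h2 := cat_rec j
    rw [show 2*(j+1) = 2*j+2 by ring]
    push_cast at h
    have : (2*(j:ℝ)+4) ≠ 0 := by positivity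
    apply mul_left_cancel₀ this
    rw [h, pow_succ]
    field_simp
    linear_combination -2*h2

lemma mom_odd (m : ℕ) (hm : Odd m) : ∫ u in (-1:ℝ)..1, u^m * √(1-u^2) = 0 := by
  have h := intervalIntegral.integral_comp_neg (a := -1) (b := 1) (fun u : ℝ => u^m * √(1-u^2))
  simp only [hm.neg_pow, neg_sq, neg_neg, neg_mul, intervalIntegral.integral_neg] at h
  linarith

/-- The terms of the double expansion of the integrand. -/
noncomputable def dterm (z u : ℝ) (p : ℕ × ℕ) : ℝ :=
  (catalan p.1 : ℝ) * ((p.2 + 2*p.1).choose (2*p.1)) * z^(2*p.1) * (2*u*z)^p.2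

lemma dterm_inner {z u : ℝ} (hz0 : 0 < z) (hz : z < 1/4) (hu : |u| ≤ 1) (k : ℕ) :
    HasSum (fun m => dterm z u (k, m))
      ((1 - 2*u*z)⁻¹ * ((catalan k : ℝ) * (z^2/(1-2*u*z)^2)^k)) := by
  have hr : ‖2*u*z‖ < 1 := by
    rw [Real.norm_eq_abs, abs_lt]
    have := abs_le.1 hu
    constructor <;> nlinarith
  have h := (hasSum_choose_mul_geometric_of_norm_lt_one (2*k) hr).mul_left ((catalan k : ℝ) * z^(2*k))
  have hw : 1 - 2*u*z ≠ 0 := by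
    have := (abs_lt.1 hr).2
    linarith
  convert h using 1
  · rfl
  · funext m; simp only [dterm]; ring
  · rw [div_pow, ← pow_mul, ← pow_mul, pow_succ]
    field_simp

lemma w_bounds {z u : ℝ} (hz0 : 0 < z) (hz : z < 1/4) (hu : |u| ≤ 1) :
    0 < 1 - 2*u*z ∧ 0 ≤ z^2/(1-2*u*z)^2 ∧ z^2/(1-2*u*z)^2 ≤ 1/4 := by
  have := abs_le.1 hu
  have hw : 1/2 < 1 - 2*u*z := by nlinarith
  refine ⟨by linarith, by positivity, ?_⟩
  rw [div_le_iff₀ (by nlinarith)]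
  nlinarith

lemma dterm_bound_summable {z : ℝ} (hz0 : 0 < z) (hz : z < 1/4) : Summable (dterm z 1) := by
  have h1 : |(1:ℝ)| ≤ 1 := by simp
  obtain ⟨a, b, c⟩ := w_bounds hz0 hz h1
  rw [summable_prod_of_nonneg (fun p => by simp only [dterm, Pi.zero_apply]; positivity)]
  refine ⟨fun k => (dterm_inner hz0 hz h1 k).summable, ?_⟩
  simp_rw [(dterm_inner hz0 hz h1 _).tsum_eq]
  exact (cat_summable b c).mul_left _

lemma dterm_le {z u : ℝ} (hz0 : 0 < z) (hu : |u| ≤ 1) (p : ℕ × ℕ) :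
    ‖dterm z u p‖ ≤ dterm z 1 p := by
  simp only [dterm, norm_mul, norm_pow, Real.norm_eq_abs, Nat.abs_cast, abs_of_pos hz0, Nat.abs_ofNat]
  gcongr

lemma dterm_hasSum {z u : ℝ} (hz0 : 0 < z) (hz : z < 1/4) (hu : |u| ≤ 1) :
    HasSum (dterm z u) ((1 - 2*u*z - √((1-2*u*z)^2 - 4*z^2)) / (2*z^2)) := by
  have hs : Summable (dterm z u) :=
    Summable.of_norm_bounded (dterm_bound_summable hz0 hz) (dterm_le hz0 hu)
  obtain ⟨a, b, c⟩ := w_bounds hz0 hz hu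
  have h1 := hs.hasSum.prod_fiberwise (dterm_inner hz0 hz hu)
  have h2 := (cat_summable b c).hasSum.mul_left (1 - 2*u*z)⁻¹
  have h3 := h1.unique h2
  have h4 := cat_tsum b c
  have h5 : √((1-2*u*z)^2 - 4*z^2) = (1-2*u*z) * √(1 - 4*(z^2/(1-2*u*z)^2)) := by
    rw [← Real.sqrt_sq a.le, ← Real.sqrt_mul (sq_nonneg _), Real.sqrt_sq a.le]
    congr 1
    field_simp
  have h6 : (1 - 2*u*z - √((1-2*u*z)^2 - 4*z^2)) / (2*z^2) = ∑' p, dterm z u p := by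
    rw [h3, h5, show √(1 - 4*(z^2/(1-2*u*z)^2)) = 1 - 2 * (z^2/(1-2*u*z)^2) *
      ∑' k : ℕ, (catalan k : ℝ) * (z^2/(1-2*u*z)^2)^k by linarith]
    generalize ∑' k : ℕ, (catalan k : ℝ) * (z^2/(1-2*u*z)^2)^k = c
    field_simp
    ring
  rw [h6]
  exact hs.hasSum

lemma int_hasSum {z : ℝ} (hz0 : 0 < z) (hz : z < 1/4) :
    HasSum (fun p : ℕ × ℕ => ∫ u in (-1:ℝ)..1, dterm z u p * √(1-u^2))
      (∫ u in (-1:ℝ)..1, ((1 - 2*u*z - √((1-2*u*z)^2 - 4*z^2)) / (2*z^2)) * √(1-u^2)) := by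
  have hab : ∀ t ∈ Set.uIoc (-1:ℝ) 1, |t| ≤ 1 := by
    intro t ht
    rw [Set.uIoc_of_le (by norm_num)] at ht
    exact abs_le.2 ⟨ht.1.le, ht.2⟩
  refine intervalIntegral.hasSum_integral_of_dominated_convergence (fun p _ => dterm z 1 p)
    ?_ ?_ ?_ ?_ ?_
  · intro p
    refine Continuous.aestronglyMeasurable ?_
    unfold dterm
    fun_prop
  · intro p
    refine Filter.Eventually.of_forall fun t ht => ?_
    rw [norm_mul]
    have h1 : ‖√(1-t^2)‖ ≤ 1 := by
      rw [Real.norm_eq_abs, abs_of_nonneg (Real.sqrt_nonneg _), Real.sqrt_le_iff]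
      refine ⟨by norm_num, ?_⟩
      nlinarith [sq_nonneg t]
    exact (mul_le_of_le_one_right (norm_nonneg _) h1).trans (dterm_le hz0 (hab t ht) p)
  · exact Filter.Eventually.of_forall fun t ht => dterm_bound_summable hz0 hz
  · exact intervalIntegrable_const
  · exact Filter.Eventually.of_forall fun t ht => (dterm_hasSum hz0 hz (hab t ht)).mul_right _

lemma int_dterm (z : ℝ) (p : ℕ × ℕ) : ∫ u in (-1:ℝ)..1, dterm z u p * √(1-u^2) =
    (catalan p.1 : ℝ) * ((p.2 + 2*p.1).choose (2*p.1)) * z^(2*p.1) * (2*z)^p.2 *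
      ∫ u in (-1:ℝ)..1, u^p.2 * √(1-u^2) := by
  rw [← intervalIntegral.integral_const_mul]
  congr 1
  funext u
  simp only [dterm]
  rw [show 2*u*z = 2*z*u by ring, mul_pow (2*z) u]
  ring

lemma final_hasSum {z : ℝ} (hz0 : 0 < z) (hz : z < 1/4) :
    HasSum (fun n : ℕ => Real.pi / 2 * ((catalan n : ℝ) * (catalan (n + 1) : ℝ) * z ^ (2 * n)))
      (∫ u in (-1:ℝ)..1, ((1 - 2*u*z - √((1-2*u*z)^2 - 4*z^2)) / (2*z^2)) * √(1-u^2)) := by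
  have h := int_hasSum hz0 hz
  simp_rw [int_dterm] at h
  have hinj : Function.Injective (fun p : ℕ × ℕ => (p.1, 2*p.2)) := by
    rintro ⟨a, b⟩ ⟨c, d⟩ h
    simp at h ⊢
    exact h
  rw [← hinj.hasSum_iff] at h
  · rw [← HasAntidiagonal.sigmaAntidiagonalEquivProd.hasSum_iff] at h
    refine h.sigma fun n => ?_
    have h2 := hasSum_fintype (fun c : HasAntidiagonal.antidiagonal n =>
      Real.pi / 2 * z^(2*n) * ((catalan c.1.1 : ℝ) * catalan c.1.2 * ((2*n).choose (2*c.1.2))))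
    have h3 := Finset.sum_coe_sort (HasAntidiagonal.antidiagonal n) (fun c : ℕ × ℕ =>
      Real.pi / 2 * z^(2*n) * ((catalan c.1 : ℝ) * catalan c.2 * ((2*n).choose (2*c.2))))
    rw [h3, ← mul_sum, cat_comb] at h2
    convert h2 using 1
    · funext c
      obtain ⟨⟨k, j⟩, hc⟩ := c
      have hc' := HasAntidiagonal.mem_antidiagonal.1 hc
      simp only at hc'
      subst hc'
      simp only [Function.comp, HasAntidiagonal.sigmaAntidiagonalEquivProd_apply]
      rw [mom_even, Nat.choose_symm_of_eq_add (show 2*(k+j) = 2*j+2*k by ring),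
        show 2*j+2*k = 2*(k+j) by ring, mul_pow 2 z, pow_mul 2 2 j]
      norm_num
      field_simp
      ring
    · ring
  · rintro ⟨k, m⟩ hm
    rcases Nat.even_or_odd' m with ⟨j, rfl | rfl⟩
    · exact absurd ⟨(k, j), rfl⟩ hm
    · simp only
      rw [mom_odd _ ⟨j, rfl⟩, mul_zero]

theorem stmt_14 (z : ℝ) (hz0 : 0 < z) (hz : z < 1 / 4) :
    (1 / Real.pi) * ∫ u in (-1 : ℝ)..1,
        ((1 - 2 * u * z - Real.sqrt ((1 - 2 * u * z) ^ 2 - 4 * z ^ 2)) / z ^ 2) *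
          Real.sqrt (1 - u ^ 2) =
      ∑' n : ℕ, (catalan n : ℝ) * (catalan (n + 1) : ℝ) * z ^ (2 * n) := by
  have h := (final_hasSum hz0 hz).tsum_eq
  rw [tsum_mul_left] at h
  have e : ∫ u in (-1 : ℝ)..1,
        ((1 - 2 * u * z - Real.sqrt ((1 - 2 * u * z) ^ 2 - 4 * z ^ 2)) / z ^ 2) *
          Real.sqrt (1 - u ^ 2) = 2 * ∫ u in (-1:ℝ)..1,
          ((1 - 2*u*z - √((1-2*u*z)^2 - 4*z^2)) / (2*z^2)) * √(1-u^2) := by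
    rw [← intervalIntegral.integral_const_mul]
    congr 1
    funext u
    field_simp
  rw [e, ← h]
  field_simp
end
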